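/- The number of reduced Latin triangles of side length 6 is exactly 236. -/

import Mathlib

/-- The index set of a Latin triangle of side length `n`:
pairs `(i,j)` of positive integers with `i + j ≤ n + 1`. -/
def TriIdx (n : ℕ) : Type :=
  {p : ℕ × ℕ // 1 ≤ p.1 ∧ 1 ≤ p.2 ∧ p.1 + p.2 ≤ n + 1}

/-- `M` is a Latin triangle of side length `n`: it assigns to each pair `(i,j)`
of positive integers with `i + j ≤ n + 1` a value in `{1,…,n}`, taking distinct
values on each row (same `i`), each left diagonal (same `j`), and each right
diagonal (same `i + j`). -/
def IsLatinTriangle (n : ℕ) (M : TriIdx n → ℕ) : Prop :=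
  (∀ p : TriIdx n, 1 ≤ M p ∧ M p ≤ n) ∧
  (∀ p q : TriIdx n, p.val.1 = q.val.1 → p ≠ q → M p ≠ M q) ∧
  (∀ p q : TriIdx n, p.val.2 = q.val.2 → p ≠ q → M p ≠ M q) ∧
  (∀ p q : TriIdx n, p.val.1 + p.val.2 = q.val.1 + q.val.2 → p ≠ q → M p ≠ M q)

/-- A Latin triangle is reduced if its bottom row is the identity:
`M (1, j) = j` for all `j`. -/
def IsReducedLatinTriangle (n : ℕ) (M : TriIdx n → ℕ) : Prop :=
  ∀ p : TriIdx n, p.val.1 = 1 → M p = p.val.2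

/-- Two cells lie on a common line. -/
def conf (c d : ℕ × ℕ) : Bool :=
  Nat.beq c.1 d.1 || (Nat.beq c.2 d.2 || Nat.beq (c.1 + c.2) (d.1 + d.2))

/-- The value `v` may be put into cell `c` given the values `l` of the cells `cs`. -/
def okv (c : ℕ × ℕ) (cs : List (ℕ × ℕ)) (l : List ℕ) (v : ℕ) : Bool :=
  (!(Nat.beq c.1 1) || Nat.beq v c.2) &&
    (cs.zip l).all fun p => !(Nat.beq v p.2) || !(conf c p.1)

/-- All admissible fillings of a list of cells. -/
def sols : List (ℕ × ℕ) → List (List ℕ)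
  | [] => [[]]
  | c :: cs => (sols cs).flatMap fun l =>
      ([1, 2, 3, 4, 5, 6].filter (okv c cs l)).map fun v => v :: l

/-- The cells of the triangle, in reverse search order. -/
def cells : List (ℕ × ℕ) :=
  [(2, 1), (3, 1), (2, 2), (4, 1), (3, 2), (2, 3), (5, 1), (4, 2), (3, 3), (2, 4),
   (6, 1), (5, 2), (4, 3), (3, 4), (2, 5), (1, 6), (1, 5), (1, 4), (1, 3), (1, 2), (1, 1)]

/-- The constraint imposed on a single cell. -/
def good (f : ℕ × ℕ → ℕ) (c : ℕ × ℕ) : Prop :=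
  1 ≤ f c ∧ f c ≤ 6 ∧ (c.1 = 1 → f c = c.2)

theorem sols_length : (sols cells).length = 236 := by
  decide +kernel

theorem sols_nodup (cs : List (ℕ × ℕ)) : (sols cs).Nodup := by
  induction cs with
  | nil => simp [sols]
  | cons c cs ih =>
    rw [sols, List.nodup_flatMap]
    refine ⟨fun l _ => ?_, ?_⟩
    · refine List.Nodup.map (fun a b h => by simpa using h) (List.Nodup.filter _ (by decide))
    · refine List.Pairwise.imp ?_ ih
      intro a b hab
      simp only [Function.onFun, List.disjoint_left, List.mem_map]
      rintro x ⟨v, _, rfl⟩ ⟨w, _, h⟩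
      simp only [List.cons.injEq] at h
      exact hab h.2.symm

theorem mem_zip_map (cs : List (ℕ × ℕ)) (f : ℕ × ℕ → ℕ) (P : (ℕ × ℕ) × ℕ → Prop) :
    (∀ p ∈ cs.zip (cs.map f), P p) ↔ ∀ d ∈ cs, P (d, f d) := by
  induction cs with
  | nil => simp
  | cons c cs ih =>
    simp only [List.map_cons, List.zip_cons_cons, List.forall_mem_cons, ih]

theorem mem_six (v : ℕ) : v ∈ [1, 2, 3, 4, 5, 6] ↔ 1 ≤ v ∧ v ≤ 6 := by
  simp only [List.mem_cons, List.not_mem_nil, or_false]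
  omega

theorem map_mem_sols (cs : List (ℕ × ℕ)) (f : ℕ × ℕ → ℕ) :
    cs.map f ∈ sols cs ↔
      (∀ c ∈ cs, good f c) ∧ cs.Pairwise fun c d => conf c d = true → f c ≠ f d := by
  induction cs with
  | nil => simp [sols]
  | cons c cs ih =>
    have key : List.map f (c :: cs) ∈ sols (c :: cs) ↔
        cs.map f ∈ sols cs ∧ (1 ≤ f c ∧ f c ≤ 6) ∧ okv c cs (cs.map f) (f c) = true := by
      simp only [sols, List.mem_flatMap, List.mem_map, List.mem_filter, List.map_cons,
        List.cons.injEq, mem_six]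
      constructor
      · rintro ⟨l, hl, v, ⟨hv, hok⟩, rfl, rfl⟩
        exact ⟨hl, hv, hok⟩
      · rintro ⟨hl, hv, hok⟩
        exact ⟨_, hl, _, ⟨hv, hok⟩, rfl, rfl⟩
    have hok : okv c cs (cs.map f) (f c) = true ↔
        (c.1 = 1 → f c = c.2) ∧ ∀ d ∈ cs, conf c d = true → f c ≠ f d := by
      rw [okv, Bool.and_eq_true, List.all_eq_true, mem_zip_map]
      refine and_congr ?_ (forall₂_congr fun d _ => ?_)
      · simp only [Bool.or_eq_true, Bool.not_eq_true', Nat.beq_eq]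
        rw [← Bool.not_eq_true, Nat.beq_eq]
        tauto
      · simp only [Bool.or_eq_true, Bool.not_eq_true']
        rw [← Bool.not_eq_true, Nat.beq_eq, ← Bool.not_eq_true]
        tauto
    rw [key, hok, ih, List.pairwise_cons, List.forall_mem_cons]
    unfold good
    tauto

theorem sols_eq_map (cs : List (ℕ × ℕ)) (hn : cs.Nodup) (l : List ℕ) (hl : l ∈ sols cs) :
    ∃ f : ℕ × ℕ → ℕ, cs.map f = l := by
  induction cs generalizing l with
  | nil => exact ⟨fun _ => 0, by simp only [sols, List.mem_singleton] at hl; simp [hl]⟩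
  | cons c cs ih =>
    simp only [sols, List.mem_flatMap, List.mem_map] at hl
    obtain ⟨l', hl', v, _, rfl⟩ := hl
    rw [List.nodup_cons] at hn
    obtain ⟨f, rfl⟩ := ih hn.2 l' hl'
    refine ⟨Function.update f c v, ?_⟩
    rw [List.map_cons, Function.update_self]
    congr 1
    refine List.map_congr_left fun d hd => Function.update_of_ne ?_ _ _
    rintro rfl
    exact hn.1 hd

theorem mem_cells (p : ℕ × ℕ) : p ∈ cells ↔ 1 ≤ p.1 ∧ 1 ≤ p.2 ∧ p.1 + p.2 ≤ 6 + 1 := by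
  constructor
  · have h : ∀ q ∈ cells, 1 ≤ q.1 ∧ 1 ≤ q.2 ∧ q.1 + q.2 ≤ 6 + 1 := by decide
    exact h p
  · obtain ⟨i, j⟩ := p
    rintro ⟨h1, h2, h3⟩
    simp only at h1 h2 h3
    have h : ∀ i : Fin 7, ∀ j : Fin 7, 1 ≤ i.val ∧ 1 ≤ j.val ∧ i.val + j.val ≤ 7 →
        (i.val, j.val) ∈ cells := by decide
    exact h ⟨i, by omega⟩ ⟨j, by omega⟩ ⟨h1, h2, h3⟩

theorem cells_nodup : cells.Nodup := by decide

/-- Extend a function on the triangle to all pairs. -/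
noncomputable def ext0 (M : TriIdx 6 → ℕ) (p : ℕ × ℕ) : ℕ :=
  open Classical in
  if h : 1 ≤ p.1 ∧ 1 ≤ p.2 ∧ p.1 + p.2 ≤ 6 + 1 then M ⟨p, h⟩ else 0

theorem ext0_val (M : TriIdx 6 → ℕ) (p : TriIdx 6) : ext0 M p.val = M p := by
  unfold ext0
  rw [dif_pos p.property]
  rfl

theorem conf_iff (c d : ℕ × ℕ) :
    conf c d = true ↔ c.1 = d.1 ∨ c.2 = d.2 ∨ c.1 + c.2 = d.1 + d.2 := by
  simp only [conf, Bool.or_eq_true, Nat.beq_eq]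

theorem triangle_iff (M : TriIdx 6 → ℕ) (f : ℕ × ℕ → ℕ) (hf : ∀ p : TriIdx 6, f p.val = M p) :
    (IsLatinTriangle 6 M ∧ IsReducedLatinTriangle 6 M) ↔ cells.map f ∈ sols cells := by
  have hsym : Std.Symm fun c d : ℕ × ℕ => conf c d = true → f c ≠ f d := by
    refine ⟨fun c d h hc => ?_⟩
    refine (h ?_).symm
    rw [conf_iff] at hc ⊢
    omega
  rw [map_mem_sols]
  constructor
  · rintro ⟨⟨hr, h1, h2, h3⟩, hred⟩
    refine ⟨fun c hc => ?_, ?_⟩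
    · have := hf ⟨c, (mem_cells c).1 hc⟩
      simp only at this
      unfold good
      rw [this]
      exact ⟨(hr _).1, (hr _).2, fun h => hred ⟨c, (mem_cells c).1 hc⟩ h⟩
    · refine List.Pairwise.imp_of_mem ?_ cells_nodup
      intro c d hc hd hne hcd
      have e1 := hf ⟨c, (mem_cells c).1 hc⟩
      have e2 := hf ⟨d, (mem_cells d).1 hd⟩
      simp only at e1 e2
      rw [e1, e2]
      have hne' : (⟨c, (mem_cells c).1 hc⟩ : TriIdx 6) ≠ ⟨d, (mem_cells d).1 hd⟩ :=
        fun h => hne (congrArg Subtype.val h)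
      rcases (conf_iff c d).1 hcd with h | h | h
      · exact h1 _ _ h hne'
      · exact h2 _ _ h hne'
      · exact h3 _ _ h hne'
  · rintro ⟨hg, hp⟩
    have hall : ∀ p q : TriIdx 6, conf p.val q.val = true → p ≠ q → M p ≠ M q := by
      intro p q hc hne
      rw [← hf p, ← hf q]
      exact hp.forall ((mem_cells _).2 p.property) ((mem_cells _).2 q.property)
        (fun h => hne (Subtype.ext h)) hc
    have hgood : ∀ p : TriIdx 6, good f p.val := fun p => hg _ ((mem_cells _).2 p.property)
    refine ⟨⟨fun p => ?_, fun p q h => hall p q ((conf_iff _ _).2 (Or.inl h)),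
      fun p q h => hall p q ((conf_iff _ _).2 (Or.inr (Or.inl h))),
      fun p q h => hall p q ((conf_iff _ _).2 (Or.inr (Or.inr h)))⟩, fun p h => ?_⟩
    · rw [← hf p]
      exact ⟨(hgood p).1, (hgood p).2.1⟩
    · rw [← hf p]
      exact (hgood p).2.2 h

/-- The number of reduced Latin triangles of side length 6 is exactly 236. -/
theorem reduced_latin_triangles_side_6 :
    Set.ncard {M : TriIdx 6 → ℕ |
      IsLatinTriangle 6 M ∧ IsReducedLatinTriangle 6 M} = 236 := by
  have hinj : Function.Injective fun M : TriIdx 6 → ℕ => cells.map (ext0 M) := by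
    intro M N h
    funext p
    rw [← ext0_val M p, ← ext0_val N p]
    exact List.map_inj_left.1 h _ ((mem_cells _).2 p.property)
  rw [← Set.ncard_image_of_injective _ hinj]
  have himg : (fun M : TriIdx 6 → ℕ => cells.map (ext0 M)) '' {M : TriIdx 6 → ℕ |
      IsLatinTriangle 6 M ∧ IsReducedLatinTriangle 6 M} =
      ((sols cells).toFinset : Set (List ℕ)) := by
    ext l
    simp only [Set.mem_image, Set.mem_ofPred_eq, List.coe_toFinset]
    constructor
    · rintro ⟨M, hM, rfl⟩
      exact (triangle_iff M _ (ext0_val M)).1 hM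
    · intro hl
      obtain ⟨f, rfl⟩ := sols_eq_map cells cells_nodup l hl
      refine ⟨fun p => f p.val, (triangle_iff _ f fun _ => rfl).2 hl, ?_⟩
      refine List.map_congr_left fun c hc => ?_
      exact ext0_val (fun p => f p.val) ⟨c, (mem_cells c).1 hc⟩
  rw [himg, Set.ncard_coe_finset, List.toFinset_card_of_nodup (sols_nodup cells), sols_length]
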